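/- Let A ∈ ℝ^{n×n} be symmetric positive definite with A = Σ_{i=1}^{E} B_i for symmetric positive semidefinite matrices B_i, let P_1,…,P_N with A_j = P_jᵀAP_j and M⁻¹ = Σ_{j=1}^N P_j A_j⁻¹ P_jᵀ be an additive Schwarz setup for A, and for each i let N_i be the number of j with B_i P_j ≠ 0. Set γ = 1 / max_i N_i. Then every eigenvalue of γ M⁻¹ A lies in the interval (0, 1], and consequently ρ(I − γ M⁻¹ A) < 1: the relaxed additive Schwarz smoother is stable. -/

import Mathlib

open Matrix BigOperators

section

variable {ι m n : Type*} [Fintype m] [Fintype n]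

/-- A real matrix that is self-adjoint for the inner product of a positive definite matrix has only
real eigenvalues, and these have real eigenvectors. -/
theorem Matrix.PosDef.exists_real_eigenvector [DecidableEq n] {A T : Matrix n n ℝ}
    (hA : A.PosDef) (hAT : (A * T).IsSymm) {μ : ℂ}
    (hμ : μ ∈ spectrum ℂ (T.map Complex.ofReal)) :
    μ.im = 0 ∧ ∃ x : n → ℝ, x ≠ 0 ∧ T *ᵥ x = μ.re • x := by
  rw [← Matrix.spectrum_toLin', ← Module.End.hasEigenvalue_iff_mem_spectrum] at hμ
  obtain ⟨v, hv⟩ := hμ.exists_hasEigenvector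
  have hTv := hv.apply_eq_smul
  set x : n → ℝ := fun i => (v i).re with hx
  set y : n → ℝ := fun i => (v i).im with hy
  have hTx : T *ᵥ x = μ.re • x - μ.im • y := by
    ext i
    have h := congrArg Complex.re (congrFun hTv i)
    simpa [mulVec, dotProduct, hx, hy] using h
  have hTy : T *ᵥ y = μ.re • y + μ.im • x := by
    ext i
    have h := congrArg Complex.im (congrFun hTv i)
    simpa [mulVec, dotProduct, hx, hy] using h
  have hxy : x ≠ 0 ∨ y ≠ 0 := by
    by_contra! h
    refine hv.2 (funext fun i => Complex.ext ?_ ?_)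
    · exact congrFun h.1 i
    · exact congrFun h.2 i
  have hxx : 0 ≤ x ⬝ᵥ A *ᵥ x := hA.posSemidef.dotProduct_mulVec_nonneg x
  have hyy : 0 ≤ y ⬝ᵥ A *ᵥ y := hA.posSemidef.dotProduct_mulVec_nonneg y
  have hpos : 0 < x ⬝ᵥ A *ᵥ x + y ⬝ᵥ A *ᵥ y := by
    rcases hxy with h | h
    · exact add_pos_of_pos_of_nonneg (hA.dotProduct_mulVec_pos h) hyy
    · exact add_pos_of_nonneg_of_pos hxx (hA.dotProduct_mulVec_pos h)
  have hsymm : x ⬝ᵥ (A * T) *ᵥ y = y ⬝ᵥ (A * T) *ᵥ x := by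
    rw [← dotProduct_transpose_mulVec, hAT.eq]
  have hAsymm : x ⬝ᵥ A *ᵥ y = y ⬝ᵥ A *ᵥ x := by
    rw [← dotProduct_transpose_mulVec, ← conjTranspose_eq_transpose_of_trivial, hA.isHermitian.eq]
  have him : μ.im = 0 := by
    simp only [← mulVec_mulVec, hTx, hTy, mulVec_add, mulVec_sub, mulVec_smul, dotProduct_add,
      dotProduct_sub, dotProduct_smul, smul_eq_mul, hAsymm] at hsymm
    have : μ.im * (x ⬝ᵥ A *ᵥ x + y ⬝ᵥ A *ᵥ y) = 0 := by linarith
    exact (mul_eq_zero.mp this).resolve_right hpos.ne'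
  refine ⟨him, ?_⟩
  rcases hxy with h | h
  · exact ⟨x, h, by simpa [him] using hTx⟩
  · exact ⟨y, h, by simpa [him] using hTy⟩

theorem Matrix.PosSemidef.dotProduct_mulVec_sum_le {B : Matrix n n ℝ} (hB : B.PosSemidef)
    (s : Finset ι) (p : ι → n → ℝ) :
    (∑ j ∈ s, p j) ⬝ᵥ B *ᵥ (∑ j ∈ s, p j) ≤ s.card * ∑ j ∈ s, p j ⬝ᵥ B *ᵥ p j := by
  have h : 0 ≤ ∑ j ∈ s, ∑ k ∈ s, (p j - p k) ⬝ᵥ B *ᵥ (p j - p k) :=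
    Finset.sum_nonneg fun j _ => Finset.sum_nonneg fun k _ =>
      hB.dotProduct_mulVec_nonneg (p j - p k)
  simp only [mulVec_sub, dotProduct_sub, sub_dotProduct, Finset.sum_sub_distrib, Finset.sum_const,
    nsmul_eq_mul, ← Finset.mul_sum] at h
  rw [Finset.sum_comm (f := fun j k => p k ⬝ᵥ B *ᵥ p j)] at h
  simp only [mulVec_sum, sum_dotProduct, dotProduct_sum]
  rw [Finset.sum_comm]
  linarith

/-- The correction operator `P (Pᵀ A P)⁻¹ Pᵀ A` of the subspace spanned by the columns of `P`. -/
noncomputable def schwarzProjection [DecidableEq m] (A : Matrix n n ℝ) (P : Matrix n m ℝ) :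
    Matrix n n ℝ :=
  P * (Pᵀ * A * P)⁻¹ * Pᵀ * A

variable [DecidableEq m] {A : Matrix n n ℝ} {P : Matrix n m ℝ}

theorem isSymm_mul_schwarzProjection (hA : A.IsSymm) : (A * schwarzProjection A P).IsSymm := by
  simp only [IsSymm, schwarzProjection, transpose_mul, transpose_nonsing_inv, transpose_transpose,
    hA.eq, Matrix.mul_assoc]

theorem transpose_mul_mul_schwarzProjection (hA : A.PosDef) (hP : Function.Injective P.mulVec) :
    Pᵀ * A * schwarzProjection A P = Pᵀ * A := by
  have hu : IsUnit (Pᵀ * A * P).det := by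
    rw [← isUnit_iff_isUnit_det, ← conjTranspose_eq_transpose_of_trivial]
    exact (hA.conjTranspose_mul_mul_same hP).isUnit
  have : Pᵀ * A * schwarzProjection A P = (Pᵀ * A * P) * (Pᵀ * A * P)⁻¹ * (Pᵀ * A) := by
    simp only [schwarzProjection, Matrix.mul_assoc]
  rw [this, mul_nonsing_inv _ hu, Matrix.one_mul]

theorem schwarzProjection_energy (hA : A.PosDef) (hP : Function.Injective P.mulVec) (z : n → ℝ) :
    (schwarzProjection A P *ᵥ z) ⬝ᵥ A *ᵥ (schwarzProjection A P *ᵥ z) =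
      z ⬝ᵥ A *ᵥ (schwarzProjection A P *ᵥ z) := by
  have hs : A.IsSymm := by
    rw [IsSymm, ← conjTranspose_eq_transpose_of_trivial, hA.isHermitian.eq]
  have h : (schwarzProjection A P)ᵀ * (A * schwarzProjection A P) = A * schwarzProjection A P := by
    rw [← Matrix.mul_assoc]
    nth_rewrite 2 [← hs.eq]
    rw [← transpose_mul, (isSymm_mul_schwarzProjection hs).eq]
    conv_lhs => enter [1]; rw [schwarzProjection]
    simp only [Matrix.mul_assoc]
    rw [← Matrix.mul_assoc Pᵀ A (schwarzProjection A P),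
      transpose_mul_mul_schwarzProjection hA hP]
    simp only [schwarzProjection, Matrix.mul_assoc]
  simp only [mulVec_mulVec]
  conv_rhs => rw [← h, ← mulVec_mulVec, dotProduct_transpose_mulVec]
  exact dotProduct_comm _ _

end

section

variable {ι κ n : Type*} [Fintype ι] [Fintype κ] [Fintype n] {m : ι → Type*}
  [∀ j, Fintype (m j)] [∀ j, DecidableEq (m j)] {A : Matrix n n ℝ} {P : ∀ j, Matrix n (m j) ℝ}

theorem sum_schwarzProjection_energy (hA : A.PosDef)
    (hP : ∀ j, Function.Injective (P j).mulVec) (z : n → ℝ) :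
    z ⬝ᵥ A *ᵥ ((∑ j, schwarzProjection A (P j)) *ᵥ z) =
      ∑ j, (schwarzProjection A (P j) *ᵥ z) ⬝ᵥ A *ᵥ (schwarzProjection A (P j) *ᵥ z) := by
  simp only [schwarzProjection_energy hA (hP _), sum_mulVec, mulVec_sum, dotProduct_sum]

theorem sum_schwarzProjection_energy_pos (hA : A.PosDef)
    (hP : ∀ j, Function.Injective (P j).mulVec)
    (hspan : ∀ z : n → ℝ, ∃ zs : ∀ j, m j → ℝ, z = ∑ j, P j *ᵥ zs j) {z : n → ℝ} (hz : z ≠ 0) :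
    0 < z ⬝ᵥ A *ᵥ ((∑ j, schwarzProjection A (P j)) *ᵥ z) := by
  rw [sum_schwarzProjection_energy hA hP]
  have hnonneg : ∀ j ∈ Finset.univ, 0 ≤
      (schwarzProjection A (P j) *ᵥ z) ⬝ᵥ A *ᵥ (schwarzProjection A (P j) *ᵥ z) :=
    fun j _ => hA.posSemidef.dotProduct_mulVec_nonneg _
  refine (Finset.sum_nonneg hnonneg).lt_of_ne fun h => ?_
  have hQ : ∀ j, schwarzProjection A (P j) *ᵥ z = 0 := fun j => by
    by_contra hne
    exact (hA.dotProduct_mulVec_pos hne).ne'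
      ((Finset.sum_eq_zero_iff_of_nonneg hnonneg).mp h.symm j (Finset.mem_univ j))
  have hPA : ∀ j, (P j)ᵀ *ᵥ (A *ᵥ z) = 0 := fun j => by
    rw [mulVec_mulVec, ← transpose_mul_mul_schwarzProjection hA (hP j), ← mulVec_mulVec, hQ,
      mulVec_zero]
  obtain ⟨zs, hzs⟩ := hspan z
  have hzero : z ⬝ᵥ A *ᵥ z = 0 := by
    conv_lhs => enter [1]; rw [hzs]
    rw [sum_dotProduct]
    refine Finset.sum_eq_zero fun j _ => ?_
    rw [dotProduct_comm, ← dotProduct_transpose_mulVec, hPA, dotProduct_zero]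
  exact (hA.dotProduct_mulVec_pos hz).ne' hzero

theorem energy_sum_schwarzProjection_le (hA : A.PosDef) {B : κ → Matrix n n ℝ}
    (hB : ∀ i, (B i).PosSemidef) (hsum : A = ∑ i, B i)
    (hP : ∀ j, Function.Injective (P j).mulVec) {K : ℕ}
    (hK : ∀ i, Nat.card {j // B i * P j ≠ 0} ≤ K) (z : n → ℝ) :
    ((∑ j, schwarzProjection A (P j)) *ᵥ z) ⬝ᵥ A *ᵥ ((∑ j, schwarzProjection A (P j)) *ᵥ z) ≤
      K * z ⬝ᵥ A *ᵥ ((∑ j, schwarzProjection A (P j)) *ᵥ z) := by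
  classical
  rw [sum_schwarzProjection_energy hA hP]
  set p : ι → n → ℝ := fun j => schwarzProjection A (P j) *ᵥ z with hp
  have hBp : ∀ i j, B i * P j = 0 → B i *ᵥ p j = 0 := fun i j h => by
    simp only [hp, mulVec_mulVec, schwarzProjection, ← Matrix.mul_assoc, h, Matrix.zero_mul,
      zero_mulVec]
  have hlocal : ∀ i, (∑ j, p j) ⬝ᵥ B i *ᵥ (∑ j, p j) ≤ K * ∑ j, p j ⬝ᵥ B i *ᵥ p j := fun i => by
    set s : Finset ι := {j | B i * P j ≠ 0} with hs
    have hcard : s.card ≤ K := by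
      simpa [hs, Nat.card_eq_fintype_card, Fintype.card_subtype] using hK i
    have hvanish : ∀ j ∈ Finset.univ, j ∉ s → B i *ᵥ p j = 0 := fun j _ hj =>
      hBp i j (by simpa [hs] using hj)
    have hBsum : B i *ᵥ (∑ j, p j) = B i *ᵥ (∑ j ∈ s, p j) := by
      simp only [mulVec_sum]
      exact (Finset.sum_subset s.subset_univ hvanish).symm
    have hBT : (B i)ᵀ = B i := by
      rw [← conjTranspose_eq_transpose_of_trivial, (hB i).isHermitian.eq]
    have hleft : (∑ j, p j) ⬝ᵥ B i *ᵥ (∑ j, p j) =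
        (∑ j ∈ s, p j) ⬝ᵥ B i *ᵥ (∑ j ∈ s, p j) := by
      rw [hBsum, ← dotProduct_transpose_mulVec, hBT, hBsum]
    have hright : ∑ j ∈ s, p j ⬝ᵥ B i *ᵥ p j = ∑ j, p j ⬝ᵥ B i *ᵥ p j :=
      Finset.sum_subset s.subset_univ fun j hj hjs => by
        rw [hvanish j hj hjs, dotProduct_zero]
    rw [hleft, ← hright]
    refine ((hB i).dotProduct_mulVec_sum_le s p).trans ?_
    gcongr
    exact Finset.sum_nonneg fun j _ => (hB i).dotProduct_mulVec_nonneg (p j)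
  have hAB : ∀ x : n → ℝ, x ⬝ᵥ A *ᵥ x = ∑ i, x ⬝ᵥ B i *ᵥ x := fun x => by
    rw [hsum, sum_mulVec, dotProduct_sum]
  rw [sum_mulVec, hAB]
  simp only [hAB]
  rw [Finset.sum_comm, Finset.mul_sum]
  exact Finset.sum_le_sum fun i _ => hlocal i

end

/-- Stability of the relaxed additive Schwarz smoother: with `γ = 1 / max_i N_i`,
every eigenvalue of `γ M⁻¹ A` lies in `(0, 1]`, and consequently every eigenvalue of
`I - γ M⁻¹ A` has modulus `< 1`, i.e. `ρ(I - γ M⁻¹ A) < 1`. -/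
theorem stmt_8 (n N E : ℕ) (A : Matrix (Fin n) (Fin n) ℝ) (hA : A.PosDef)
    (B : Fin E → Matrix (Fin n) (Fin n) ℝ) (hB : ∀ i, (B i).PosSemidef)
    (hsum : A = ∑ i, B i)
    (nj : Fin N → ℕ) (P : (j : Fin N) → Matrix (Fin n) (Fin (nj j)) ℝ)
    (hrank : ∀ j, Function.Injective (P j).mulVec)
    (hspan : ∀ z : Fin n → ℝ, ∃ zs : (j : Fin N) → Fin (nj j) → ℝ,
      z = ∑ j, (P j).mulVec (zs j))
    (Minv : Matrix (Fin n) (Fin n) ℝ)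
    (hMinv : Minv = ∑ j, P j * ((P j)ᵀ * A * P j)⁻¹ * (P j)ᵀ)
    (Ni : Fin E → ℕ)
    (hNi : ∀ i, Ni i = Nat.card {j : Fin N // B i * P j ≠ 0})
    (γ : ℝ) (hγ : γ = 1 / ((Finset.univ.sup Ni : ℕ) : ℝ)) :
    (∀ μ ∈ spectrum ℂ ((γ • (Minv * A)).map Complex.ofReal),
        μ.im = 0 ∧ 0 < μ.re ∧ μ.re ≤ 1) ∧
    (∀ μ ∈ spectrum ℂ
        (((1 : Matrix (Fin n) (Fin n) ℝ) - γ • (Minv * A)).map Complex.ofReal),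
      ‖μ‖ < 1) := by
  have hs : A.IsSymm := by
    rw [IsSymm, ← conjTranspose_eq_transpose_of_trivial, hA.isHermitian.eq]
  set K : ℕ := Finset.univ.sup Ni with hKdef
  have hK : ∀ i, Nat.card {j : Fin N // B i * P j ≠ 0} ≤ K := fun i =>
    hNi i ▸ Finset.le_sup (f := Ni) (Finset.mem_univ i)
  set Q : Matrix (Fin n) (Fin n) ℝ := ∑ j, schwarzProjection A (P j) with hQdef
  have hMA : Minv * A = Q := by
    rw [hMinv, hQdef, Finset.sum_mul]
    rfl
  rw [hMA]
  have hAQ : (A * Q).IsSymm := by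
    rw [IsSymm, hQdef, Finset.mul_sum, transpose_sum]
    exact Finset.sum_congr rfl fun j _ => (isSymm_mul_schwarzProjection hs).eq
  have hAT : (A * (γ • Q)).IsSymm := by
    rw [Matrix.mul_smul]
    exact hAQ.smul γ
  have hbound : ∀ (x : Fin n → ℝ) (a : ℝ), x ≠ 0 → (γ • Q) *ᵥ x = a • x → 0 < a ∧ a ≤ 1 := by
    intro x a hx hax
    have hxx : 0 < x ⬝ᵥ A *ᵥ x := hA.dotProduct_mulVec_pos hx
    have hpos : 0 < x ⬝ᵥ A *ᵥ (Q *ᵥ x) := sum_schwarzProjection_energy_pos hA hrank hspan hx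
    have hle : (Q *ᵥ x) ⬝ᵥ A *ᵥ (Q *ᵥ x) ≤ K * x ⬝ᵥ A *ᵥ (Q *ᵥ x) :=
      energy_sum_schwarzProjection_le hA hB hsum hrank hK x
    have hQx : Q *ᵥ x ≠ 0 := fun h => by simp [h] at hpos
    have hKpos : (0 : ℝ) < K :=
      pos_of_mul_pos_left ((hA.dotProduct_mulVec_pos hQx).trans_le hle) hpos.le
    have hγpos : 0 < γ := hγ ▸ one_div_pos.mpr hKpos
    have hKγ : γ * K = 1 := by rw [hγ, one_div_mul_cancel hKpos.ne']
    rw [smul_mulVec] at hax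
    have hray : γ * x ⬝ᵥ A *ᵥ (Q *ᵥ x) = a * x ⬝ᵥ A *ᵥ x := by
      simpa [mulVec_smul] using congrArg (fun w => x ⬝ᵥ A *ᵥ w) hax
    have hray2 : γ * (γ * (Q *ᵥ x) ⬝ᵥ A *ᵥ (Q *ᵥ x)) = a * (a * x ⬝ᵥ A *ᵥ x) := by
      simpa [mulVec_smul] using congrArg (fun w => w ⬝ᵥ A *ᵥ w) hax
    have ha : 0 < a := pos_of_mul_pos_left (hray ▸ mul_pos hγpos hpos) hxx.le
    refine ⟨ha, ?_⟩
    have h : a * (a * x ⬝ᵥ A *ᵥ x) ≤ 1 * (a * x ⬝ᵥ A *ᵥ x) := by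
      calc a * (a * x ⬝ᵥ A *ᵥ x) = γ * (γ * (Q *ᵥ x) ⬝ᵥ A *ᵥ (Q *ᵥ x)) := hray2.symm
        _ ≤ γ * (γ * (K * x ⬝ᵥ A *ᵥ (Q *ᵥ x))) := by gcongr
        _ = (γ * K) * (γ * x ⬝ᵥ A *ᵥ (Q *ᵥ x)) := by ring
        _ = 1 * (a * x ⬝ᵥ A *ᵥ x) := by rw [hKγ, hray]
    exact le_of_mul_le_mul_right h (mul_pos ha hxx)
  refine ⟨fun μ hμ => ?_, fun μ hμ => ?_⟩
  · obtain ⟨him, x, hx, hxe⟩ := hA.exists_real_eigenvector hAT hμ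
    exact ⟨him, hbound x _ hx hxe⟩
  · have hA1T : (A * (1 - γ • Q)).IsSymm := by
      rw [Matrix.mul_sub, Matrix.mul_one]
      exact hs.sub hAT
    obtain ⟨him, x, hx, hxe⟩ := hA.exists_real_eigenvector hA1T hμ
    have hxe' : (γ • Q) *ᵥ x = (1 - μ.re) • x := by
      rw [sub_mulVec, one_mulVec] at hxe
      rw [sub_smul, one_smul, ← hxe, sub_sub_cancel]
    obtain ⟨h0, h1⟩ := hbound x _ hx hxe'
    have hre : μ = (μ.re : ℂ) := Complex.ext rfl (by simpa using him)
    rw [hre, Complex.norm_real, Real.norm_eq_abs, abs_lt]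
    constructor <;> linarith
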